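/- Let G be a countable group with word-length function ℓ associated to a finite generating set, let H be a subgroup of G, and let R ⊆ G be a set containing exactly one element of minimal ℓ-length from each right coset Hg. Then for every f : G → ℂ the following are equivalent: (i) for every k ∈ ℕ, Σ_{g∈G} |f(g)|·(1+ℓ(g))^k < ∞; (ii) for every k ∈ ℕ, Σ_{(h,r)∈H×R} |f(hr)|·(1+ℓ(h))^k·(1+ℓ(r))^k < ∞. (This is the Fréchet-space content of the isomorphism S G ≅ S H ⊗̂ S(G/H).) -/

import Mathlib

/-- The word-length function associated to a generating set `S` of a group. -/
noncomputable def wordLength {G : Type*} [Group G] (S : Set G) (g : G) : ℕ :=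
  sInf {n | ∃ w : List G, w.length = n ∧ (∀ x ∈ w, x ∈ S ∨ x⁻¹ ∈ S) ∧ w.prod = g}

lemma wl_exists {G : Type*} [Group G] (S : Set G) (hS : Subgroup.closure S = ⊤) (g : G) :
    ∃ w : List G, w.length = wordLength S g ∧ (∀ x ∈ w, x ∈ S ∨ x⁻¹ ∈ S) ∧ w.prod = g := by
  have hg : g ∈ Subgroup.closure S := by rw [hS]; trivial
  rw [← Subgroup.mem_toSubmonoid, Subgroup.closure_toSubmonoid] at hg
  obtain ⟨w, hw, hp⟩ := Submonoid.exists_list_of_mem_closure hg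
  exact Nat.sInf_mem (s := {n | ∃ w : List G, w.length = n ∧
    (∀ x ∈ w, x ∈ S ∨ x⁻¹ ∈ S) ∧ w.prod = g}) ⟨w.length, w, rfl, hw, hp⟩

lemma wl_le {G : Type*} [Group G] (S : Set G) (w : List G) (hw : ∀ x ∈ w, x ∈ S ∨ x⁻¹ ∈ S) :
    wordLength S w.prod ≤ w.length :=
  Nat.sInf_le ⟨w, rfl, hw, rfl⟩

lemma wl_mul {G : Type*} [Group G] (S : Set G) (hS : Subgroup.closure S = ⊤) (a b : G) :
    wordLength S (a * b) ≤ wordLength S a + wordLength S b := by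
  obtain ⟨u, hu, hu', hup⟩ := wl_exists S hS a
  obtain ⟨v, hv, hv', hvp⟩ := wl_exists S hS b
  rw [← hu, ← hv, ← hup, ← hvp, ← List.prod_append, ← List.length_append]
  apply wl_le
  intro x hx
  rcases List.mem_append.1 hx with h | h
  · exact hu' x h
  · exact hv' x h

lemma wl_inv {G : Type*} [Group G] (S : Set G) (hS : Subgroup.closure S = ⊤) (a : G) :
    wordLength S a⁻¹ ≤ wordLength S a := by
  obtain ⟨u, hu, hu', hup⟩ := wl_exists S hS a
  have h := wl_le S (u.map (·⁻¹)).reverse (by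
    intro x hx
    simp only [List.mem_reverse, List.mem_map] at hx
    obtain ⟨y, hy, rfl⟩ := hx
    rw [inv_inv]
    exact (hu' y hy).symm)
  rw [← List.prod_inv_reverse, hup] at h
  simpa [hu] using h

/-- The Fréchet-space content of the isomorphism `S G ≅ S H ⊗̂ S(G/H)`: for a set `R` of
minimal-length right coset representatives, `f` lies in `S G` if and only if the function
`(h, r) ↦ f(hr)` lies in the corresponding doubly-weighted `ℓ¹` space on `H × R`. -/
theorem schwartz_decomposition_along_cosets
    {G : Type*} [Group G] [Countable G]
    (S : Finset G) (hS : Subgroup.closure (S : Set G) = ⊤)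
    (H : Subgroup G) (R : Set G)
    (hR : ∀ g : G, ∃! r : G, r ∈ R ∧ ∃ h ∈ H, g = h * r)
    (hmin : ∀ r ∈ R, ∀ h ∈ H, wordLength (S : Set G) r ≤ wordLength (S : Set G) (h * r))
    (f : G → ℂ) :
    (∀ k : ℕ, Summable fun g : G =>
        ‖f g‖ * (1 + (wordLength (S : Set G) g : ℝ)) ^ k) ↔
    (∀ k : ℕ, Summable fun p : H × R =>
        ‖f ((p.1 : G) * (p.2 : G))‖ *
          (1 + (wordLength (S : Set G) (p.1 : G) : ℝ)) ^ k *
          (1 + (wordLength (S : Set G) (p.2 : G) : ℝ)) ^ k) := by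
  have hbij : Function.Bijective (fun p : H × R => (p.1 : G) * (p.2 : G)) := by
    constructor
    · rintro ⟨⟨h, hh⟩, ⟨r, hr⟩⟩ ⟨⟨h', hh'⟩, ⟨r', hr'⟩⟩ he
      simp only at he
      have e : r = r' := (hR (h * r)).unique ⟨hr, h, hh, rfl⟩ ⟨hr', h', hh', he⟩
      subst e
      have e2 : h = h' := mul_right_cancel he
      subst e2
      rfl
    · intro g
      obtain ⟨r, ⟨hr, h, hh, e⟩, -⟩ := hR g
      exact ⟨(⟨h, hh⟩, ⟨r, hr⟩), e.symm⟩
  have key : ∀ k : ℕ, (Summable fun g : G =>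
        ‖f g‖ * (1 + (wordLength (S : Set G) g : ℝ)) ^ k) ↔
      Summable fun p : H × R => ‖f ((p.1 : G) * (p.2 : G))‖ *
        (1 + (wordLength (S : Set G) ((p.1 : G) * (p.2 : G)) : ℝ)) ^ k := fun k =>
    ((Equiv.ofBijective _ hbij).summable_iff (f := fun g : G =>
        ‖f g‖ * (1 + (wordLength (S : Set G) g : ℝ)) ^ k)).symm
  constructor
  · intro h k
    refine Summable.of_nonneg_of_le (fun p => by positivity) (fun p => ?_)
      (((key (2 * k)).1 (h (2 * k))).mul_left ((2 : ℝ) ^ k))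
    obtain ⟨⟨a, ha⟩, ⟨r, hr⟩⟩ := p
    simp only
    have h1 : (wordLength (S : Set G) r : ℝ) ≤ wordLength (S : Set G) (a * r) := by
      exact_mod_cast hmin r hr a ha
    have h2 : (wordLength (S : Set G) a : ℝ) ≤ 2 * wordLength (S : Set G) (a * r) := by
      have e1 := wl_mul (S : Set G) hS (a * r) r⁻¹
      have e2 := wl_inv (S : Set G) hS r
      have e3 := hmin r hr a ha
      rw [mul_inv_cancel_right] at e1
      exact_mod_cast (by omega : wordLength (S : Set G) a ≤ 2 * wordLength (S : Set G) (a * r))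
    generalize (wordLength (S : Set G) (a * r)) = n at *
    have h3 : (1 + (wordLength (S : Set G) a : ℝ)) ^ k ≤ (2 * (1 + (n : ℝ))) ^ k := by
      gcongr
      linarith
    calc _ ≤ ‖f (a * r)‖ * (2 * (1 + (n : ℝ))) ^ k * (1 + (n : ℝ)) ^ k := by gcongr
      _ = _ := by rw [mul_pow, two_mul k, pow_add]; ring
  · intro h k
    refine (key k).2 (Summable.of_nonneg_of_le (fun p => by positivity) (fun p => ?_) (h k))
    rw [mul_assoc, ← mul_pow]
    have e : (wordLength (S : Set G) ((p.1 : G) * (p.2 : G)) : ℝ) ≤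
        wordLength (S : Set G) (p.1 : G) + wordLength (S : Set G) (p.2 : G) := by
      exact_mod_cast wl_mul (S : Set G) hS _ _
    have e' : (0 : ℝ) ≤ (wordLength (S : Set G) (p.1 : G) : ℝ) *
        wordLength (S : Set G) (p.2 : G) := by positivity
    gcongr
    linarith
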